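/- Let d ≥ 0 and let x ∈ {0,1}^(4^(d+1)) be A-winnable (NAND_{2(d+1)}(x) = 1), with consecutive quarters x^{00}, x^{01}, x^{10}, x^{11} and halves x^b = x^{b0} x^{b1} for b ∈ {0,1}. Suppose b ∈ {0,1} is such that x^b is A-winnable and C_A(x^{b0}) + C_A(x^{b1}) ≤ 2 (C_A(x^{b̄0}) + C_A(x^{b̄1})), where b̄ = 1 − b and the right-hand side may be ∞. Then C_A(x^b) ≤ (3/2) C_A(x). -/

import Mathlib

open scoped ENNReal
open scoped Classical

namespace NandTree

/-- The bit-`b` half of an input of length `2^(m+1)`: `b = false` gives the first half,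
`b = true` the second half (lexicographic indexing, first bit most significant). -/
def halfInput (m : ℕ) (b : Bool) (x : Fin (2^(m+1)) → Bool) : Fin (2^m) → Bool :=
  fun i => x ⟨(cond b 1 0) * 2^m + i.val, by
    have h := i.isLt
    have h2 : (2:ℕ)^(m+1) = 2^m * 2 := pow_succ 2 m
    cases b <;> simp only [cond_true, cond_false] <;> omega⟩

/-- The value `NAND_ℓ(x)` of a depth-`ℓ` NAND-tree instance: internal nodes at even
distance from the leaves are OR gates, at odd distance AND gates. -/
def nand : (ℓ : ℕ) → (Fin (2^ℓ) → Bool) → Bool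
  | 0, x => x ⟨0, by norm_num⟩
  | (ℓ+1), x =>
    if (ℓ+1) % 2 = 0 then
      nand ℓ (halfInput ℓ false x) || nand ℓ (halfInput ℓ true x)
    else
      nand ℓ (halfInput ℓ false x) && nand ℓ (halfInput ℓ true x)

/-- Index of a leaf given by a root-to-leaf bit string (lexicographic, first bit most
significant). -/
def leafIdx (s : List Bool) : ℕ := s.foldl (fun n b => 2 * n + cond b 1 0) 0

/-- The value of the leaf reached by bit string `s` in instance `x`. -/
def leafVal (m : ℕ) (x : Fin (2^m) → Bool) (s : List Bool) : Bool :=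
  if h : leafIdx s < 2^m then x ⟨leafIdx s, h⟩ else false

/-- The root-to-leaf path determined by strategies `σA`, `σB` (each assigning a choice of
child to every node, nodes being given by the list of choices from the root): at a node
at distance `m+1` from the leaves, Player A chooses a child if `m+1` is even, else
Player B chooses. -/
def gamePath (σA σB : List Bool → Bool) : (m : ℕ) → List Bool → List Bool
  | 0, p => p
  | (m+1), p => gamePath σA σB m (p ++ [if (m+1) % 2 = 0 then σA p else σB p])

/-- `winning Z m x σ`: strategy `σ` is a winning strategy for player `Z` (`true` = A,
`false` = B) in the two-player game on the depth-`m` instance `x`: against every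
opponent strategy, the reached leaf has value `Z` (A wins on `1 = true`, B on
`0 = false`). -/
def winning (Z : Bool) (m : ℕ) (x : Fin (2^m) → Bool) (σ : List Bool → Bool) : Prop :=
  ∀ τ : List Bool → Bool,
    leafVal m x (gamePath (if Z then σ else τ) (if Z then τ else σ) m []) = Z

mutual

/-- The criticality `c(v)` of the root of a depth-`m` subtree with input `y`. -/
noncomputable def crit : (m : ℕ) → (Fin (2^m) → Bool) → ℝ≥0∞
  | 0, _ => 1
  | 1, y => if y ⟨0, by norm_num⟩ = y ⟨1, by norm_num⟩ then 1 else 2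
  | (m+2), y =>
    if nand (m+2) y ≠ decide ((m+2) % 2 = 0) then 1
    else if nand (m+1) (halfInput (m+1) false y) ≠ nand (m+1) (halfInput (m+1) true y) then 2
    else
      (max (CZ (decide ((m+2) % 2 = 0)) m (halfInput m false (halfInput (m+1) false y)) +
            CZ (decide ((m+2) % 2 = 0)) m (halfInput m true (halfInput (m+1) false y)))
           (CZ (decide ((m+2) % 2 = 0)) m (halfInput m false (halfInput (m+1) true y)) +
            CZ (decide ((m+2) % 2 = 0)) m (halfInput m true (halfInput (m+1) true y)))) /
      (((CZ (decide ((m+2) % 2 = 0)) m (halfInput m false (halfInput (m+1) false y)) +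
         CZ (decide ((m+2) % 2 = 0)) m (halfInput m true (halfInput (m+1) false y))) +
        ((CZ (decide ((m+2) % 2 = 0)) m (halfInput m false (halfInput (m+1) true y)) +
          CZ (decide ((m+2) % 2 = 0)) m (halfInput m true (halfInput (m+1) true y))))) / 2)
termination_by m _ => (m, 0)

/-- The expected product, over the random choices of `Z`'s opponent, of the criticalities
of the nodes at which `Z` moves along the path played according to strategy `σ`. -/
noncomputable def pathProd (Z : Bool) :
    (σ : List Bool → Bool) → (m : ℕ) → (Fin (2^m) → Bool) → ℝ≥0∞
  | _, 0, _ => 1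
  | σ, (m+1), y =>
    if decide ((m+1) % 2 = 0) = Z then
      crit (m+1) y * pathProd Z (fun q => σ (σ [] :: q)) m (halfInput m (σ []) y)
    else
      (pathProd Z (fun q => σ (false :: q)) m (halfInput m false y) +
       pathProd Z (fun q => σ (true :: q)) m (halfInput m true y)) / 2
termination_by _ m _ => (m, 1)

/-- The average choice complexity `C_Z` of a depth-`m` instance `y` for player `Z`
(`true` = A, `false` = B): the infimum, over `Z`-winning strategies, of the expected
product of criticalities over the nodes where `Z` moves (and `∞` if `Z` has no winning
strategy, the infimum over the empty set being `⊤`). -/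
noncomputable def CZ (Z : Bool) (m : ℕ) (y : Fin (2^m) → Bool) : ℝ≥0∞ :=
  ⨅ σ ∈ {σ : List Bool → Bool | winning Z m y σ}, pathProd Z σ m y
termination_by (m, 2)

end

theorem leafIdx_foldl (s : List Bool) : ∀ n : ℕ,
    s.foldl (fun n b => 2 * n + cond b 1 0) n = n * 2 ^ s.length + leafIdx s := by
  induction s with
  | nil => intro n; simp [leafIdx]
  | cons a t ih =>
    intro n
    have h1 := ih (2 * n + cond a 1 0)
    have h2 := ih (2 * 0 + cond a 1 0)
    unfold leafIdx
    rw [List.foldl_cons, List.foldl_cons, h1, h2, List.length_cons, pow_succ]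
    ring

theorem leafIdx_cons (b : Bool) (s : List Bool) :
    leafIdx (b :: s) = (cond b 1 0) * 2 ^ s.length + leafIdx s := by
  have := leafIdx_foldl s (2 * 0 + cond b 1 0)
  unfold leafIdx at *
  rw [List.foldl_cons, this]
  simp

theorem leafVal_cons (m : ℕ) (x : Fin (2^(m+1)) → Bool) (b : Bool) (s : List Bool)
    (hs : s.length = m) :
    leafVal (m+1) x (b :: s) = leafVal m (halfInput m b x) s := by
  have hlt : ∀ t : List Bool, leafIdx t < 2 ^ t.length := by
    intro t
    induction t with
    | nil => simp [leafIdx]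
    | cons a t ih =>
      rw [leafIdx_cons, List.length_cons, pow_succ]
      cases a <;> simp only [cond_true, cond_false] <;> omega
  have h1 := hlt s
  have h2 := hlt (b :: s)
  rw [List.length_cons] at h2
  rw [hs] at h1 h2
  unfold leafVal halfInput
  rw [dif_pos h1, dif_pos h2]
  congr 1
  apply Fin.ext
  simp only [leafIdx_cons, hs]

theorem gamePath_prefix (σA σB : List Bool → Bool) (m : ℕ) : ∀ p : List Bool,
    ∃ s, s.length = m ∧ gamePath σA σB m p = p ++ s ∧
      ∀ (q : List Bool) (τA τB : List Bool → Bool),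
        (∀ l, τA (q ++ l) = σA (p ++ l)) → (∀ l, τB (q ++ l) = σB (p ++ l)) →
        gamePath τA τB m q = q ++ s := by
  induction m with
  | zero => intro p; exact ⟨[], rfl, by simp [gamePath], by intros; simp [gamePath]⟩
  | succ m ih =>
    intro p
    obtain ⟨s, hs, h1, h2⟩ := ih (p ++ [if (m+1) % 2 = 0 then σA p else σB p])
    refine ⟨(if (m+1) % 2 = 0 then σA p else σB p) :: s, by simp [hs], ?_, ?_⟩
    · rw [gamePath, h1]; simp
    · intro q τA τB hA hB
      have eA := hA []
      have eB := hB []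
      simp only [List.append_nil] at eA eB
      rw [gamePath, eA, eB, h2]
      · simp
      · intro l; rw [List.append_assoc, hA, List.append_assoc]
      · intro l; rw [List.append_assoc, hB, List.append_assoc]

theorem leaf_step (m : ℕ) (x : Fin (2^(m+1)) → Bool) (σA σB : List Bool → Bool) (c : Bool)
    (hc : (if (m+1) % 2 = 0 then σA [] else σB []) = c) :
    leafVal (m+1) x (gamePath σA σB (m+1) []) =
      leafVal m (halfInput m c x)
        (gamePath (fun q => σA (c :: q)) (fun q => σB (c :: q)) m []) := by
  rw [gamePath, hc]
  obtain ⟨s, hs, h1, h2⟩ := gamePath_prefix σA σB m ([] ++ [c])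
  rw [h1, h2 [] _ _ (by simp) (by simp)]
  simpa using leafVal_cons m x c s hs

theorem winning_own (Z : Bool) (m : ℕ) (x : Fin (2^(m+1)) → Bool) (σ : List Bool → Bool)
    (hZ : decide ((m+1) % 2 = 0) = Z) :
    winning Z (m+1) x σ ↔ winning Z m (halfInput m (σ []) x) (fun q => σ (σ [] :: q)) := by
  have key : ∀ τ : List Bool → Bool,
      leafVal (m+1) x (gamePath (if Z then σ else τ) (if Z then τ else σ) (m+1) []) =
      leafVal m (halfInput m (σ []) x) (gamePath (if Z then (fun q => σ (σ [] :: q)) else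
        (fun q => τ (σ [] :: q))) (if Z then (fun q => τ (σ [] :: q)) else
        (fun q => σ (σ [] :: q))) m []) := by
    intro τ
    rw [leaf_step m x _ _ (σ [])]
    · cases Z <;> rfl
    · cases Z <;> simp_all
  constructor
  · intro h τ
    have := h (fun l => τ l.tail)
    rw [key] at this
    simpa using this
  · intro h τ
    rw [key]
    exact h _

theorem winning_opp (Z : Bool) (m : ℕ) (x : Fin (2^(m+1)) → Bool) (σ : List Bool → Bool)
    (hZ : ¬ decide ((m+1) % 2 = 0) = Z) :
    winning Z (m+1) x σ ↔ ∀ b, winning Z m (halfInput m b x) (fun q => σ (b :: q)) := by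
  have key : ∀ τ : List Bool → Bool,
      leafVal (m+1) x (gamePath (if Z then σ else τ) (if Z then τ else σ) (m+1) []) =
      leafVal m (halfInput m (τ []) x) (gamePath (if Z then (fun q => σ (τ [] :: q)) else
        (fun q => τ (τ [] :: q))) (if Z then (fun q => τ (τ [] :: q)) else
        (fun q => σ (τ [] :: q))) m []) := by
    intro τ
    rw [leaf_step m x _ _ (τ [])]
    · cases Z <;> rfl
    · cases Z <;> simp_all
  constructor
  · intro h b τ
    have := h (fun l => if l = [] then b else τ l.tail)
    rw [key] at this
    simpa using this
  · intro h τ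
    rw [key]
    exact h _ _

/-- Combine two substrategies (with a root choice). -/
def joinStrat (c : Bool) (f : Bool → List Bool → Bool) : List Bool → Bool
  | [] => c
  | b :: q => f b q

theorem exists_winning_iff (Z : Bool) (m : ℕ) : ∀ x : Fin (2^m) → Bool,
    (∃ σ, winning Z m x σ) ↔ nand m x = Z := by
  induction m with
  | zero =>
    intro x
    simp [winning, gamePath, leafVal, leafIdx, nand]
  | succ m ih =>
    intro x
    by_cases hZ : decide ((m+1) % 2 = 0) = Z
    · have h1 : (∃ σ, winning Z (m+1) x σ) ↔ ∃ c, nand m (halfInput m c x) = Z := by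
        constructor
        · rintro ⟨σ, hσ⟩
          exact ⟨_, (ih _).1 ⟨_, (winning_own Z m x σ hZ).1 hσ⟩⟩
        · rintro ⟨c, hc⟩
          obtain ⟨σ, hσ⟩ := (ih _).2 hc
          exact ⟨joinStrat c (fun _ => σ), (winning_own Z m x _ hZ).2 hσ⟩
      rw [h1, nand]
      subst hZ
      by_cases hp : (m+1) % 2 = 0 <;> simp [hp]
      cases nand m (halfInput m false x) <;> simp
    · have h1 : (∃ σ, winning Z (m+1) x σ) ↔ ∀ c, nand m (halfInput m c x) = Z := by
        constructor
        · rintro ⟨σ, hσ⟩ c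
          exact (ih _).1 ⟨_, (winning_opp Z m x σ hZ).1 hσ c⟩
        · intro h
          choose f hf using fun c => (ih _).2 (h c)
          exact ⟨joinStrat false f, (winning_opp Z m x _ hZ).2 hf⟩
      rw [h1, nand]
      by_cases hp : (m+1) % 2 = 0 <;> cases Z <;> simp_all

theorem crit_le_two : ∀ (m : ℕ) (y : Fin (2^m) → Bool), crit m y ≤ 2
  | 0, _ => by rw [crit]; norm_num
  | 1, y => by rw [crit]; split_ifs <;> norm_num
  | (m+2), y => by
    rw [crit]
    split_ifs
    · norm_num
    · norm_num
    · apply ENNReal.div_le_of_le_mul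
      rw [ENNReal.mul_div_cancel (by norm_num) (by norm_num)]
      exact max_le le_self_add le_add_self

theorem pathProd_lt_top (Z : Bool) (m : ℕ) : ∀ (σ : List Bool → Bool) (y : Fin (2^m) → Bool),
    pathProd Z σ m y < ⊤ := by
  induction m with
  | zero => intro σ y; rw [pathProd]; norm_num
  | succ m ih =>
    intro σ y
    rw [pathProd]
    split_ifs
    · exact ENNReal.mul_lt_top ((crit_le_two _ _).trans_lt (by norm_num)) (ih _ _)
    · exact ENNReal.div_lt_top (ENNReal.add_lt_top.2 ⟨ih _ _, ih _ _⟩).ne (by norm_num)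

theorem CZ_lt_top (Z : Bool) (m : ℕ) (y : Fin (2^m) → Bool) (h : nand m y = Z) :
    CZ Z m y < ⊤ := by
  obtain ⟨σ, hσ⟩ := (exists_winning_iff Z m y).2 h
  rw [CZ]
  exact (iInf₂_le σ hσ).trans_lt (pathProd_lt_top Z m σ y)

theorem CZ_opp (Z : Bool) (m : ℕ) (y : Fin (2^(m+1)) → Bool)
    (hZ : ¬ decide ((m+1) % 2 = 0) = Z) :
    CZ Z (m+1) y = (CZ Z m (halfInput m false y) + CZ Z m (halfInput m true y)) / 2 := by
  apply le_antisymm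
  · rw [ENNReal.le_div_iff_mul_le (by norm_num) (by norm_num)]
    rw [CZ.eq_1 Z m (halfInput m false y), CZ.eq_1 Z m (halfInput m true y)]
    apply ENNReal.le_iInf₂_add_iInf₂
    intro σ hσ τ hτ
    rw [← ENNReal.le_div_iff_mul_le (by norm_num) (by norm_num), CZ]
    refine (iInf₂_le (joinStrat false (fun b => if b then τ else σ))
      ((winning_opp Z m y _ hZ).2 ?_)).trans ?_
    · intro b
      cases b
      · exact hσ
      · exact hτ
    · rw [pathProd, if_neg hZ]
      exact le_rfl
  · rw [CZ.eq_1 Z (m+1)]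
    refine le_iInf₂ fun σ hσ => ?_
    have h := (winning_opp Z m y σ hZ).1 hσ
    rw [pathProd, if_neg hZ]
    gcongr
    · rw [CZ]; exact iInf₂_le (fun q => σ (false :: q)) (h false)
    · rw [CZ]; exact iInf₂_le (fun q => σ (true :: q)) (h true)

theorem le_CZ_own (Z : Bool) (m : ℕ) (y : Fin (2^(m+1)) → Bool)
    (hZ : decide ((m+1) % 2 = 0) = Z) (K r : ℝ≥0∞) (hr0 : r ≠ 0) (hr : r ≠ ⊤)
    (hK : ∀ c, nand m (halfInput m c y) = Z →
      K ≤ r * (crit (m+1) y * CZ Z m (halfInput m c y))) :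
    K ≤ r * CZ Z (m+1) y := by
  rw [← ENNReal.div_le_iff' hr0 hr]
  rw [CZ]
  refine le_iInf₂ fun σ hσ => ?_
  have h := (winning_own Z m y σ hZ).1 hσ
  refine ((ENNReal.div_le_iff' hr0 hr).2 (hK (σ []) ((exists_winning_iff _ _ _).1 ⟨_, h⟩))).trans ?_
  rw [pathProd, if_pos hZ]
  gcongr
  rw [CZ]; exact iInf₂_le (fun q => σ (σ [] :: q)) h

theorem arith (s t u M : ℝ≥0∞) (hs : s < ⊤) (ht : t < ⊤) (h : s ≤ 2 * t)
    (hu : u = s ∨ u = t) (hM : M = max s t) :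
    s / 2 ≤ 3 / 2 * (M / ((s + t) / 2) * (u / 2)) := by
  lift s to NNReal using hs.ne
  lift t to NNReal using ht.ne
  have h' : s ≤ 2 * t := by exact_mod_cast h
  by_cases h0 : s = 0
  · simp [h0]
  have hsp : 0 < s := pos_iff_ne_zero.2 h0
  have hne : (s + t) / 2 ≠ 0 := by positivity
  obtain ⟨v, rfl, hv⟩ : ∃ v : NNReal, u = v ∧ (v = s ∨ v = t) := by
    rcases hu with rfl | rfl
    · exact ⟨s, rfl, Or.inl rfl⟩
    · exact ⟨t, rfl, Or.inr rfl⟩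
  have hmain : s / 2 ≤ 3 / 2 * (max s t / ((s + t) / 2) * (v / 2)) := by
    have e : 3 / 2 * (max s t / ((s + t) / 2) * (v / 2)) = (3 / 2 * max s t * v) / (s + t) := by
      field_simp
    rw [e, le_div_iff₀ (by positivity)]
    rw [← NNReal.coe_le_coe] at h' ⊢
    rw [← NNReal.coe_pos] at hsp
    have h1 : (s:ℝ) ≤ max s t := le_max_left _ _
    have h2 : (t:ℝ) ≤ max s t := le_max_right _ _
    push_cast at *
    have ht0 : (0:ℝ) ≤ t := t.2
    rcases hv with rfl | rfl <;> nlinarith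
  have := ENNReal.coe_le_coe.2 hmain
  subst hM
  have h2 : ((2:NNReal):ℝ≥0∞) = 2 := rfl
  have h3 : ((3:NNReal):ℝ≥0∞) = 3 := rfl
  rw [ENNReal.coe_mul, ENNReal.coe_mul, ENNReal.coe_div (by norm_num), ENNReal.coe_div (by norm_num),
    ENNReal.coe_div hne, ENNReal.coe_div (by norm_num), ENNReal.coe_div (by norm_num),
    ENNReal.coe_add, ENNReal.coe_max, h2, h3] at this
  exact this

theorem half_finite (d : ℕ) (y : Fin (2^(2*d+1)) → Bool) (h : nand (2*d+1) y = true) :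
    CZ true (2*d) (halfInput (2*d) false y) + CZ true (2*d) (halfInput (2*d) true y) < ⊤ := by
  rw [nand, if_neg (by omega), Bool.and_eq_true] at h
  exact ENNReal.add_lt_top.2 ⟨CZ_lt_top _ _ _ h.1, CZ_lt_top _ _ _ h.2⟩

/-- If `x` of depth `2(d+1)` is A-winnable, `x^b` is A-winnable, and
`C_A(x^{b0}) + C_A(x^{b1}) ≤ 2 (C_A(x^{b̄0}) + C_A(x^{b̄1}))` (the right side possibly
`∞`), then `C_A(x^b) ≤ (3/2) C_A(x)`. -/
theorem CA_select_bound (d : ℕ) (x : Fin (2^(2*d+2)) → Bool)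
    (h : nand (2*d+2) x = true) (b : Bool)
    (hb : nand (2*d+1) (halfInput (2*d+1) b x) = true)
    (hle : CZ true (2*d) (halfInput (2*d) false (halfInput (2*d+1) b x)) +
           CZ true (2*d) (halfInput (2*d) true (halfInput (2*d+1) b x)) ≤
         2 * (CZ true (2*d) (halfInput (2*d) false (halfInput (2*d+1) (!b) x)) +
              CZ true (2*d) (halfInput (2*d) true (halfInput (2*d+1) (!b) x)))) :
    CZ true (2*d+1) (halfInput (2*d+1) b x) ≤ (3/2 : ℝ≥0∞) * CZ true (2*d+2) x := by
  have hodd : ¬ decide ((2*d+1) % 2 = 0) = true := by simp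
  have heven : decide ((2*d+2) % 2 = 0) = true := by simp
  have h32 : (1:ℝ≥0∞) ≤ 3 / 2 * 2 := by
    rw [ENNReal.div_mul_cancel (by norm_num) (by norm_num)]; norm_num
  by_cases hnb : nand (2*d+1) (halfInput (2*d+1) (!b) x) = true
  · have hsplit : nand (2*d+1) (halfInput (2*d+1) false x) = true ∧
        nand (2*d+1) (halfInput (2*d+1) true x) = true := by
      cases b
      · exact ⟨hb, hnb⟩
      · exact ⟨hnb, hb⟩
    have hs := half_finite d _ hb
    have ht := half_finite d _ hnb
    refine le_CZ_own true (2*d+1) x heven _ _ (by norm_num)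
      (ENNReal.div_lt_top (by norm_num) (by norm_num)).ne fun c _ => ?_
    rw [CZ_opp true (2*d) _ hodd, CZ_opp true (2*d) (halfInput (2*d+1) c x) hodd]
    rw [crit, heven, if_neg (by simp [h]), if_neg (by simp [hsplit])]
    cases b
    · refine arith _ _ _ _ hs ht hle ?_ rfl
      cases c
      · exact Or.inl rfl
      · exact Or.inr rfl
    · rw [add_comm (_ + _) (_ + _)]
      refine arith _ _ _ _ hs ht hle ?_ (max_comm _ _)
      cases c
      · exact Or.inr rfl
      · exact Or.inl rfl
  · refine le_CZ_own true (2*d+1) x heven _ _ (by norm_num)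
      (ENNReal.div_lt_top (by norm_num) (by norm_num)).ne fun c hc => ?_
    have hcb : c = b := by
      by_contra hne
      have : c = !b := by cases b <;> cases c <;> simp_all
      subst this
      exact hnb hc
    subst hcb
    rw [crit, heven, if_neg (by simp [h]), if_pos (by cases c <;> simp_all), ← mul_assoc]
    exact le_mul_of_one_le_left zero_le h32

end NandTree
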